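/- Let F(τ) = η(τ)²·η(10τ)⁶/(η(2τ)²·η(5τ)⁶) for τ with Im τ > 0. For every a, b, c, d ∈ ℤ with ad − bc = 1 and c ≡ 0 (mod 10), there exists w ∈ ℂ with w¹² = 1 such that F((aτ+b)/(cτ+d)) = w·F(τ) for all τ ∈ ℂ with Im τ > 0. -/

import Mathlib

/-- The Dedekind eta function `η(τ) = e^{πiτ/12} ∏_{n≥1} (1 - e^{2πinτ})`. -/
noncomputable def dedekindEta (τ : ℂ) : ℂ :=
  Complex.exp (Real.pi * Complex.I * τ / 12) *
    ∏' n : ℕ, (1 - Complex.exp (2 * Real.pi * Complex.I * (n + 1) * τ))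

/-- `F(τ) = η(τ)²η(10τ)⁶ / (η(2τ)²η(5τ)⁶)`. -/
noncomputable def F10B (τ : ℂ) : ℂ :=
  dedekindEta τ ^ 2 * dedekindEta (10 * τ) ^ 6 /
    (dedekindEta (2 * τ) ^ 2 * dedekindEta (5 * τ) ^ 6)

open UpperHalfPlane ModularForm MatrixGroups

lemma dedekindEta_eq_eta : dedekindEta = ModularForm.eta := by
  funext τ
  simp only [dedekindEta, ModularForm.eta, eta_q_eq_cexp, Function.Periodic.qParam]
  congr 2
  push_cast
  ring

lemma dedekindEta_ne_zero {τ : ℂ} (hτ : 0 < τ.im) : dedekindEta τ ≠ 0 := by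
  rw [dedekindEta_eq_eta]
  exact eta_ne_zero hτ

lemma continuousAt_dedekindEta {τ : ℂ} (hτ : 0 < τ.im) : ContinuousAt dedekindEta τ := by
  rw [dedekindEta_eq_eta]
  exact (differentiableAt_eta_of_mem_upperHalfPlaneSet hτ).continuousAt

lemma im_pos_natCast_mul {N : ℕ} (hN : 0 < N) {τ : ℂ} (hτ : 0 < τ.im) :
    0 < ((N : ℂ) * τ).im := by
  simpa [hN] using hτ

lemma intCast_mul_add_intCast_ne_zero {a b c d : ℤ} (h : a * d - b * c = 1) {τ : ℂ}
    (hτ : 0 < τ.im) : (c : ℂ) * τ + d ≠ 0 := by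
  intro h0
  have him := congrArg Complex.im h0
  have hre := congrArg Complex.re h0
  simp [hτ.ne'] at him hre
  subst him
  simp at hre
  subst hre
  simp at h

lemma exists_SL_smul_eq {a b c d : ℤ} (h : a * d - b * c = 1) :
    ∃ g : SL(2, ℤ), ∀ z : ℍ, ((g • z : ℍ) : ℂ) = (a * z + b) / (c * z + d) ∧
      denom g z = c * z + d := by
  obtain ⟨g, hg⟩ : ∃ g : SL(2, ℤ), (g : Matrix (Fin 2) (Fin 2) ℤ) = !![a, b; c, d] :=
    ⟨⟨!![a, b; c, d], by rw [Matrix.det_fin_two_of]; exact h⟩, rfl⟩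
  refine ⟨g, fun z ↦ ⟨?_, ?_⟩⟩
  · rw [UpperHalfPlane.coe_specialLinearGroup_apply]
    simp [hg]
  · simp [denom, hg]

lemma im_pos_moebius {a b c d : ℤ} (h : a * d - b * c = 1) {τ : ℂ} (hτ : 0 < τ.im) :
    0 < (((a : ℂ) * τ + b) / (c * τ + d)).im := by
  obtain ⟨g, hg⟩ := exists_SL_smul_eq h
  have := (g • (⟨τ, hτ⟩ : ℍ)).im_pos
  rwa [← UpperHalfPlane.coe_im, (hg _).1] at this

/-- The modularity of `η ^ 24 = Δ` in terms of matrix entries. -/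
lemma dedekindEta_moebius_pow_24 {a b c d : ℤ} (h : a * d - b * c = 1) {τ : ℂ}
    (hτ : 0 < τ.im) :
    dedekindEta ((a * τ + b) / (c * τ + d)) ^ 24 = (c * τ + d) ^ 12 * dedekindEta τ ^ 24 := by
  obtain ⟨g, hg⟩ := exists_SL_smul_eq h
  obtain ⟨z, rfl⟩ : ∃ z : ℍ, (z : ℂ) = τ := ⟨⟨τ, hτ⟩, rfl⟩
  obtain ⟨hsmul, hdenom⟩ := hg z
  have hne := intCast_mul_add_intCast_ne_zero h hτ
  have key : discriminant (g • z) * (c * z + d) ^ (-12 : ℤ) = discriminant z := by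
    rw [← hdenom, ← SL_slash_apply, SlashInvariantForm.slash_action_generators_SL2Z
      discriminant_S_invariant discriminant_T_invariant]
  rw [zpow_neg, zpow_ofNat, mul_inv_eq_iff_eq_mul₀ (pow_ne_zero _ hne)] at key
  rw [dedekindEta_eq_eta, ← hsmul, mul_comm]
  exact key

/-- `η(Nτ) ^ 24` has weight `12` for `Γ₀(N)`. -/
lemma dedekindEta_natCast_mul_moebius_pow_24 {a b c d : ℤ} (h : a * d - b * c = 1) {N : ℕ}
    (hN : 0 < N) (hc : (N : ℤ) ∣ c) {τ : ℂ} (hτ : 0 < τ.im) :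
    dedekindEta (N * ((a * τ + b) / (c * τ + d))) ^ 24 =
      (c * τ + d) ^ 12 * dedekindEta (N * τ) ^ 24 := by
  obtain ⟨c', rfl⟩ := hc
  have key := dedekindEta_moebius_pow_24 (a := a) (b := N * b) (c := c') (d := d)
    (by linear_combination h) (im_pos_natCast_mul hN hτ)
  push_cast at key ⊢
  convert key using 3
  all_goals ring

lemma F10B_ne_zero {τ : ℂ} (hτ : 0 < τ.im) : F10B τ ≠ 0 := by
  have h2 := dedekindEta_ne_zero (im_pos_natCast_mul (N := 2) (by norm_num) hτ)
  have h5 := dedekindEta_ne_zero (im_pos_natCast_mul (N := 5) (by norm_num) hτ)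
  have h10 := dedekindEta_ne_zero (im_pos_natCast_mul (N := 10) (by norm_num) hτ)
  have h1 := dedekindEta_ne_zero hτ
  push_cast at h2 h5 h10
  simp [F10B, *]

lemma continuousAt_F10B {τ : ℂ} (hτ : 0 < τ.im) : ContinuousAt F10B τ := by
  have hmul {N : ℕ} (hN : 0 < N) : ContinuousAt (fun z ↦ dedekindEta ((N : ℂ) * z)) τ :=
    ContinuousAt.comp (f := fun z ↦ (N : ℂ) * z)
      (continuousAt_dedekindEta (im_pos_natCast_mul hN hτ)) (by fun_prop)
  have h2 := hmul (N := 2) (by norm_num)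
  have h5 := hmul (N := 5) (by norm_num)
  have h10 := hmul (N := 10) (by norm_num)
  have n2 := dedekindEta_ne_zero (im_pos_natCast_mul (N := 2) (by norm_num) hτ)
  have n5 := dedekindEta_ne_zero (im_pos_natCast_mul (N := 5) (by norm_num) hτ)
  push_cast at h2 h5 h10 n2 n5
  exact (((continuousAt_dedekindEta hτ).pow 2).mul (h10.pow 6)).div
    ((h2.pow 2).mul (h5.pow 6)) (by simp [n2, n5])

/-- `F ^ 12 = Δ(τ)Δ(10τ)³ / (Δ(2τ)Δ(5τ)³)` is `Γ₀(10)`-invariant. -/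
lemma F10B_moebius_pow_12 {a b c d : ℤ} (h : a * d - b * c = 1) (hc : (10 : ℤ) ∣ c) {τ : ℂ}
    (hτ : 0 < τ.im) : F10B ((a * τ + b) / (c * τ + d)) ^ 12 = F10B τ ^ 12 := by
  have hF (z : ℂ) : F10B z ^ 12 = dedekindEta z ^ 24 * (dedekindEta (10 * z) ^ 24) ^ 3 /
      (dedekindEta (2 * z) ^ 24 * (dedekindEta (5 * z) ^ 24) ^ 3) := by
    rw [F10B, div_pow]
    congr 1 <;> ring
  have h1 := dedekindEta_moebius_pow_24 h hτ
  have h2 := dedekindEta_natCast_mul_moebius_pow_24 h (N := 2) (by norm_num)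
    (dvd_trans (by norm_num) hc) hτ
  have h5 := dedekindEta_natCast_mul_moebius_pow_24 h (N := 5) (by norm_num)
    (dvd_trans (by norm_num) hc) hτ
  have h10 := dedekindEta_natCast_mul_moebius_pow_24 h (N := 10) (by norm_num) hc hτ
  push_cast at h2 h5 h10
  have hne := intCast_mul_add_intCast_ne_zero h hτ
  rw [hF, hF, h1, h2, h5, h10]
  simp only [mul_pow, mul_mul_mul_comm]
  exact mul_div_mul_left _ _ (by positivity)

/-- The span of `F(τ) = η(τ)²η(10τ)⁶/(η(2τ)²η(5τ)⁶)` is preserved, up to a twelfth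
root of unity, by every element of `Γ₀(10)`. -/
theorem gamma0_10_invariance_10B (a b c d : ℤ) (h : a * d - b * c = 1) (hc : (10 : ℤ) ∣ c) :
    ∃ w : ℂ, w ^ 12 = 1 ∧ ∀ τ : ℂ, 0 < τ.im →
      F10B (((a : ℂ) * τ + (b : ℂ)) / ((c : ℂ) * τ + (d : ℂ))) = w * F10B τ := by
  set R : ℂ → ℂ := fun τ ↦ F10B ((a * τ + b) / (c * τ + d)) / F10B τ with hR
  have hpow {τ : ℂ} (hτ : 0 < τ.im) : R τ ^ 12 = 1 := by
    rw [hR, div_pow, F10B_moebius_pow_12 h hc hτ, div_self (pow_ne_zero _ (F10B_ne_zero hτ))]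
  have hcont : ContinuousOn R upperHalfPlaneSet := fun τ hτ ↦ by
    refine ContinuousAt.continuousWithinAt (.div ?_ (continuousAt_F10B hτ) (F10B_ne_zero hτ))
    exact ContinuousAt.comp (f := fun τ : ℂ ↦ (a * τ + b) / (c * τ + d))
      (continuousAt_F10B (im_pos_moebius h hτ))
      (.div (by fun_prop) (by fun_prop) (intCast_mul_add_intCast_ne_zero h hτ))
  have hfin : {w : ℂ | w ^ 12 = 1}.Finite := by
    refine (Polynomial.nthRootsFinset 12 (1 : ℂ)).finite_toSet.subset fun w hw ↦ ?_
    simpa [Polynomial.mem_nthRootsFinset] using hw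
  have hI : 0 < Complex.I.im := by simp
  refine ⟨R Complex.I, hpow hI, fun τ hτ ↦ ?_⟩
  rw [← (convex_halfSpace_im_gt 0).isPreconnected.constant_of_mapsTo hfin.isDiscrete
    hcont (fun _ hz ↦ hpow hz) hτ hI]
  exact (div_mul_cancel₀ _ (F10B_ne_zero hτ)).symm
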